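/- Let pi be a smooth Fpbar-representation of G and h in H_1 = I_{1,K} ∩ H. Then for every v in pi^{N'_{m_K}}, S_K(h*v) = (beta_K*h*beta_K)*S_K(v), and for every v in pi^{N_{n_K}}, S_-(h*v) = (beta_K*h*beta_K)*S_-(v). -/

import Mathlib

open scoped Classical

noncomputable section

namespace U21

/-- The arithmetic setting: `E` is the unramified quadratic extension of a non-archimedean
local field `F` of odd residue characteristic `p`, with residue field of `F` of cardinality
`q = p ^ fdeg`.  The field `E` is encoded through its valuation subring `O = o_E`, a
uniformizer `ϖ`, the maximal ideal `mI` (so that `p_E^k` is `ϖ ^ k * O`), and the nontrivial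
`F`-automorphism `conj` of `E` (which induces the `q`-power Frobenius on the residue field
of `E`, of cardinality `q ^ 2`). -/
structure Setting where
  p : ℕ
  q : ℕ
  fdeg : ℕ
  hp : p.Prime
  hodd : p ≠ 2
  hfdeg : 0 < fdeg
  hq : q = p ^ fdeg
  E : Type
  [fieldE : Field E]
  conj : E →+* E
  conj_invol : ∀ x, conj (conj x) = x
  conj_ne : conj ≠ RingHom.id E
  O : Subring E
  val_ring : ∀ x : E, x ≠ 0 → x ∈ O ∨ x⁻¹ ∈ O
  conj_O : ∀ x, x ∈ O → conj x ∈ O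
  ϖ : E
  unif_mem : ϖ ∈ O
  unif_ne : ϖ ≠ 0
  unif_conj : conj ϖ = ϖ
  unif_not_unit : ¬ IsUnit (⟨ϖ, unif_mem⟩ : O)
  disc : ∀ x : E, x ≠ 0 → ∃ (n : ℤ) (u : Oˣ), x = (u : O) * ϖ ^ n
  mI : Ideal O
  hmI : ∀ x : O, x ∈ mI ↔ ∃ y ∈ O, (x : E) = ϖ * y
  [fin_res : Fintype (O ⧸ mI)]
  card_res : Fintype.card (O ⧸ mI) = q ^ 2
  res_frob : ∀ x : O, Ideal.Quotient.mk mI ⟨conj x, conj_O x x.2⟩ = (Ideal.Quotient.mk mI x) ^ q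
  complete : ∀ a : ℕ → E,
    (∀ k : ℕ, ∃ N, ∀ m ≥ N, ∀ n ≥ N, ∃ w ∈ O, a m - a n = ϖ ^ k * w) →
    ∃ L : E, ∀ k : ℕ, ∃ N, ∀ n ≥ N, ∃ w ∈ O, a n - L = ϖ ^ k * w

attribute [instance] Setting.fieldE Setting.fin_res

namespace Setting

variable (S : Setting)

/-- 3×3 matrices over `E`. -/
abbrev M3 := Matrix (Fin 3) (Fin 3) S.E

/-- The antidiagonal matrix `β` of the Hermitian form. -/
def betaM : S.M3 := !![0,0,1;0,1,0;1,0,0]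

/-- The fractional ideal `p_E ^ k ⊆ E` (for `k : ℤ`). -/
def pE (k : ℤ) : Set S.E := {z | ∃ w ∈ S.O, z = S.ϖ ^ k * w}

/-- The unramified unitary group `G = U(2,1)(E/F)`, as a subgroup of `GL₃(E)`:
`g ∈ G` iff `g.transpose * β * conj g = β`. -/
def Gsub : Subgroup (Matrix.GeneralLinearGroup (Fin 3) S.E) where
  carrier := {g | ((g : S.M3)).transpose * S.betaM * ((g : S.M3).map S.conj) = S.betaM}
  one_mem' := by
    simp [Matrix.map_one (⇑S.conj) (map_zero S.conj) (map_one S.conj)]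
  mul_mem' := by
    intro a b ha hb
    simp only [Set.mem_setOf_eq, Units.val_mul, Matrix.transpose_mul, Matrix.map_mul] at ha hb ⊢
    calc ((b : S.M3)).transpose * ((a : S.M3)).transpose * S.betaM * ((a : S.M3).map S.conj * (b : S.M3).map S.conj)
        = ((b : S.M3)).transpose * (((a : S.M3)).transpose * S.betaM * (a : S.M3).map S.conj) * ((b : S.M3).map S.conj) := by
          simp only [mul_assoc]
      _ = S.betaM := by rw [ha]; exact hb
  inv_mem' := by
    intro a ha
    simp only [Set.mem_setOf_eq] at ha ⊢
    have hA : IsUnit ((a : S.M3)) := a.isUnit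
    have hdet : IsUnit ((a : S.M3)).det := (Matrix.isUnit_iff_isUnit_det _).mp hA
    have hAc : IsUnit (((a : S.M3)).map ⇑S.conj) := by
      rw [← RingHom.mapMatrix_apply]; exact hA.map _
    have hdetc : IsUnit ((((a : S.M3)).map ⇑S.conj).det) := (Matrix.isUnit_iff_isUnit_det _).mp hAc
    have hdetT : IsUnit ((((a : S.M3)).transpose).det) := by rw [Matrix.det_transpose]; exact hdet
    have hmapinv : ((a : S.M3)⁻¹).map ⇑S.conj = (((a : S.M3)).map ⇑S.conj)⁻¹ := by
      symm
      apply Matrix.inv_eq_left_inv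
      rw [← Matrix.map_mul, Matrix.nonsing_inv_mul _ hdet,
        Matrix.map_one (⇑S.conj) (map_zero S.conj) (map_one S.conj)]
    rw [Matrix.coe_units_inv, Matrix.transpose_nonsing_inv, hmapinv]
    conv_lhs => rw [← ha]
    calc (((a:S.M3)).transpose)⁻¹ * (((a:S.M3)).transpose * S.betaM * ((a:S.M3)).map ⇑S.conj) * (((a:S.M3)).map ⇑S.conj)⁻¹
        = (((a:S.M3)).transpose)⁻¹ * ((a:S.M3)).transpose * S.betaM *
            (((a:S.M3)).map ⇑S.conj * (((a:S.M3)).map ⇑S.conj)⁻¹) := by simp only [mul_assoc]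
      _ = S.betaM := by
          rw [Matrix.nonsing_inv_mul _ hdetT, Matrix.mul_nonsing_inv _ hdetc, one_mul, mul_one]

/-- The group `G = U(2,1)(E/F)`. -/
abbrev GG := ↥S.Gsub

/-- The matrix of an element of `G`. -/
def mat (g : S.GG) : S.M3 := ((g : Matrix.GeneralLinearGroup (Fin 3) S.E) : S.M3)

/-- The upper unipotent matrix `n(x,y)`. -/
def nM (x y : S.E) : S.M3 := !![1, x, y; 0, 1, -S.conj x; 0, 0, 1]

/-- The lower unipotent matrix `n'(x,y)`. -/
def n'M (x y : S.E) : S.M3 := !![1, 0, 0; x, 1, 0; y, -S.conj x, 1]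

/-- The diagonal matrix `h(x) = diag(x, -x̄x⁻¹, x̄⁻¹)`. -/
def hM (x : S.E) : S.M3 := !![x, 0, 0; 0, -S.conj x * x⁻¹, 0; 0, 0, (S.conj x)⁻¹]

/-- The subgroup `N` of `G` (unipotent radical of the upper triangular Borel), as a set. -/
def Nset : Set S.GG := {g | ∃ x y : S.E, x * S.conj x + y + S.conj y = 0 ∧ S.mat g = S.nM x y}

/-- The subgroup `N_k = {n(x,y) : y ∈ p_E^k}`, as a set. -/
def Nk (k : ℤ) : Set S.GG :=
  {g | ∃ x y : S.E, x * S.conj x + y + S.conj y = 0 ∧ y ∈ S.pE k ∧ S.mat g = S.nM x y}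

/-- The subgroup `N'` of `G`, as a set. -/
def N'set : Set S.GG := {g | ∃ x y : S.E, x * S.conj x + y + S.conj y = 0 ∧ S.mat g = S.n'M x y}

/-- The subgroup `N'_k = {n'(x,y) : y ∈ p_E^k}`, as a set. -/
def N'k (k : ℤ) : Set S.GG :=
  {g | ∃ x y : S.E, x * S.conj x + y + S.conj y = 0 ∧ y ∈ S.pE k ∧ S.mat g = S.n'M x y}

/-- The diagonal subgroup `H` of `G`, as a set. -/
def Hset : Set S.GG := {g | ∃ a b c : S.E, S.mat g = !![a,0,0;0,b,0;0,0,c]}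

/-- The hyperspecial maximal compact subgroup `K₀ = G ∩ GL₃(o_E)`, as a set. -/
def K0set : Set S.GG := {g | ∀ i j, S.mat g i j ∈ S.O}

/-- The special (non-hyperspecial) maximal compact subgroup `K₁`, as a set. -/
def K1set : Set S.GG :=
  {g | S.mat g 0 0 ∈ S.O ∧ S.mat g 0 1 ∈ S.O ∧ S.mat g 0 2 ∈ S.pE (-1) ∧
       S.mat g 1 0 ∈ S.pE 1 ∧ S.mat g 1 1 ∈ S.O ∧ S.mat g 1 2 ∈ S.O ∧
       S.mat g 2 0 ∈ S.pE 1 ∧ S.mat g 2 1 ∈ S.pE 1 ∧ S.mat g 2 2 ∈ S.O}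

/-- The Iwahori subgroup `I_{K₀}` (preimage of the Borel of `Γ_{K₀}`), as a set. -/
def IK0 : Set S.GG :=
  {g | g ∈ S.K0set ∧ S.mat g 1 0 ∈ S.pE 1 ∧ S.mat g 2 0 ∈ S.pE 1 ∧ S.mat g 2 1 ∈ S.pE 1}

/-- The pro-p Iwahori subgroup `I_{1,K₀}`, as a set. -/
def I1K0 : Set S.GG :=
  {g | g ∈ S.IK0 ∧ S.mat g 0 0 - 1 ∈ S.pE 1 ∧ S.mat g 1 1 - 1 ∈ S.pE 1 ∧ S.mat g 2 2 - 1 ∈ S.pE 1}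

/-- The opposite pro-p Iwahori subgroup `I'_{1,K₀}`, as a set. -/
def I1'K0 : Set S.GG :=
  {g | g ∈ S.K0set ∧ S.mat g 0 1 ∈ S.pE 1 ∧ S.mat g 0 2 ∈ S.pE 1 ∧ S.mat g 1 2 ∈ S.pE 1 ∧
       S.mat g 0 0 - 1 ∈ S.pE 1 ∧ S.mat g 1 1 - 1 ∈ S.pE 1 ∧ S.mat g 2 2 - 1 ∈ S.pE 1}

/-- The maximal normal pro-p subgroup `K₀¹` of `K₀` (principal congruence subgroup), as a set. -/
def Kone0 : Set S.GG := {g | ∀ i j, S.mat g i j - (1 : S.M3) i j ∈ S.pE 1}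

/-- The Iwahori subgroup `I_{K₁}`, as a set. -/
def IK1 : Set S.GG := {g | g ∈ S.K1set ∧ S.mat g 2 0 ∈ S.pE 2}

/-- The pro-p Iwahori subgroup `I_{1,K₁}`, as a set. -/
def I1K1 : Set S.GG :=
  {g | g ∈ S.IK1 ∧ S.mat g 0 0 - 1 ∈ S.pE 1 ∧ S.mat g 1 1 - 1 ∈ S.pE 1 ∧ S.mat g 2 2 - 1 ∈ S.pE 1}

/-- The opposite pro-p Iwahori subgroup `I'_{1,K₁}`, as a set. -/
def I1'K1 : Set S.GG :=
  {g | g ∈ S.K1set ∧ S.mat g 0 2 ∈ S.O ∧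
       S.mat g 0 0 - 1 ∈ S.pE 1 ∧ S.mat g 1 1 - 1 ∈ S.pE 1 ∧ S.mat g 2 2 - 1 ∈ S.pE 1}

/-- The maximal normal pro-p subgroup `K₁¹` of `K₁`, as a set. -/
def Kone1 : Set S.GG :=
  {g | g ∈ S.K1set ∧ S.mat g 0 2 ∈ S.O ∧ S.mat g 2 0 ∈ S.pE 2 ∧
       S.mat g 0 0 - 1 ∈ S.pE 1 ∧ S.mat g 1 1 - 1 ∈ S.pE 1 ∧ S.mat g 2 2 - 1 ∈ S.pE 1}

/-- The congruence subgroup of level `n` (used to express smoothness), as a set. -/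
def cong (n : ℕ) : Set S.GG := {g | ∀ i j, S.mat g i j - (1 : S.M3) i j ∈ S.pE n}

def alphaM : S.M3 := !![S.ϖ⁻¹, 0, 0; 0, 1, 0; 0, 0, S.ϖ]

def alphaMinv : S.M3 := !![S.ϖ, 0, 0; 0, 1, 0; 0, 0, S.ϖ⁻¹]

lemma alpha_mul_inv : S.alphaM * S.alphaMinv = 1 := by
  ext i j
  fin_cases i <;> fin_cases j <;>
    simp [alphaM, alphaMinv, Matrix.mul_apply, Fin.sum_univ_three, Matrix.one_apply,
      Matrix.vecHead, Matrix.vecTail, inv_mul_cancel₀ S.unif_ne, mul_inv_cancel₀ S.unif_ne]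

lemma alpha_inv_mul : S.alphaMinv * S.alphaM = 1 := by
  ext i j
  fin_cases i <;> fin_cases j <;>
    simp [alphaM, alphaMinv, Matrix.mul_apply, Fin.sum_univ_three, Matrix.one_apply,
      Matrix.vecHead, Matrix.vecTail, inv_mul_cancel₀ S.unif_ne, mul_inv_cancel₀ S.unif_ne]

def alphaU : Matrix.GeneralLinearGroup (Fin 3) S.E :=
  ⟨S.alphaM, S.alphaMinv, S.alpha_mul_inv, S.alpha_inv_mul⟩

lemma alphaU_mem : S.alphaU ∈ S.Gsub := by
  show ((S.alphaU : S.M3)).transpose * S.betaM * ((S.alphaU : S.M3).map S.conj) = S.betaM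
  have : (S.alphaU : S.M3) = S.alphaM := rfl
  rw [this]
  ext i j
  fin_cases i <;> fin_cases j <;>
    simp [alphaM, betaM, Matrix.mul_apply, Fin.sum_univ_three, Matrix.map_apply,
      Matrix.transpose_apply, Matrix.vecHead, Matrix.vecTail, map_inv₀, S.unif_conj,
      inv_mul_cancel₀ S.unif_ne, mul_inv_cancel₀ S.unif_ne]

/-- The element `α = diag(ϖ⁻¹, 1, ϖ)` of `G`. -/
def alphaE : S.GG := ⟨S.alphaU, S.alphaU_mem⟩

lemma beta_mul_beta : S.betaM * S.betaM = 1 := by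
  ext i j
  fin_cases i <;> fin_cases j <;>
    simp [betaM, Matrix.mul_apply, Fin.sum_univ_three, Matrix.one_apply,
      Matrix.vecHead, Matrix.vecTail]

def betaU : Matrix.GeneralLinearGroup (Fin 3) S.E :=
  ⟨S.betaM, S.betaM, S.beta_mul_beta, S.beta_mul_beta⟩

lemma betaU_mem : S.betaU ∈ S.Gsub := by
  show ((S.betaU : S.M3)).transpose * S.betaM * ((S.betaU : S.M3).map S.conj) = S.betaM
  have : (S.betaU : S.M3) = S.betaM := rfl
  rw [this]
  ext i j
  fin_cases i <;> fin_cases j <;>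
    simp [betaM, Matrix.mul_apply, Fin.sum_univ_three, Matrix.map_apply, Matrix.transpose_apply,
      Matrix.vecHead, Matrix.vecTail]

/-- The element `β` of `G`. -/
def betaE : S.GG := ⟨S.betaU, S.betaU_mem⟩

/-- The element `β' = β * α⁻¹` of `G`. -/
def betaPr : S.GG := S.betaE * S.alphaE⁻¹

/-- A finite set `U` is a set of representatives for the cosets `A/B`. -/
def IsReps (A B : Set S.GG) (U : Finset S.GG) : Prop :=
  (↑U : Set S.GG) ⊆ A ∧ ∀ a ∈ A, ∃! u, u ∈ U ∧ a⁻¹ * u ∈ B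

/-- The residue field `k_E` of `E`. -/
abbrev kE := S.O ⧸ S.mI

/-- The residue map `o_E → k_E`. -/
def resmap : S.O →+* S.kE := Ideal.Quotient.mk S.mI

/-- The group `L_{q³} = {(x,t) ∈ k_E² : x x̄ + t + t̄ = 0}` (where `x̄ = x^q`). -/
def Lbig : Set (S.kE × S.kE) := {z | z.1 * z.1 ^ S.q + z.2 + z.2 ^ S.q = 0}

/-- The group `L_q = {(0,t) ∈ k_E² : t + t̄ = 0}`. -/
def Lsmall : Set (S.kE × S.kE) := {z | z.1 = 0 ∧ z.2 + z.2 ^ S.q = 0}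

/-- `L_{q^t}` for `t ∈ {1,3}`. -/
def Lof (t : ℕ) : Set (S.kE × S.kE) := if t = 3 then S.Lbig else S.Lsmall

end Setting

/-- A choice of one of the two maximal compact open subgroups `K ∈ {K₀, K₁}` of `G`,
together with its maximal normal pro-p subgroup `K¹`, the (pro-p) Iwahori subgroups
`I_K ⊇ I_{1,K}`, the opposite pro-p Iwahori `I'_{1,K}`, the element
`β_K ∈ K ∩ {β, β'}`, and the integers `n_K, m_K, t_K`. -/
structure Chamber (S : Setting) where
  K : Subgroup S.GG
  KoneS : Set S.GG
  IK : Set S.GG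
  I1 : Set S.GG
  I1' : Set S.GG
  βK : S.GG
  nK : ℤ
  mK : ℤ
  tK : ℕ
  cases :
    ((K : Set S.GG) = S.K0set ∧ KoneS = S.Kone0 ∧ IK = S.IK0 ∧ I1 = S.I1K0 ∧ I1' = S.I1'K0 ∧
      βK = S.betaE ∧ nK = 0 ∧ mK = 1 ∧ tK = 3) ∨
    ((K : Set S.GG) = S.K1set ∧ KoneS = S.Kone1 ∧ IK = S.IK1 ∧ I1 = S.I1K1 ∧ I1' = S.I1'K1 ∧
      βK = S.betaPr ∧ nK = -1 ∧ mK = 2 ∧ tK = 1)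

namespace Chamber

variable {S : Setting} (C : Chamber S)

/-- `H₀ = H ∩ I_K`. -/
def H0 : Set S.GG := S.Hset ∩ C.IK

/-- `H₁ = H ∩ I_{1,K}`. -/
def H1 : Set S.GG := S.Hset ∩ C.I1

end Chamber

section RepTheory

variable {S : Setting} (C : Chamber S)
variable (𝔽 : Type) [Field 𝔽]

section Generic

variable {G₀ : Type} [Monoid G₀] {V : Type} [AddCommGroup V] [Module 𝔽 V]

/-- A submodule is invariant under a representation. -/
def Invt (ρ : Representation 𝔽 G₀ V) (Ssub : Submodule 𝔽 V) : Prop :=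
  ∀ g v, v ∈ Ssub → ρ g v ∈ Ssub

/-- The subrepresentation generated by a vector (the span of its orbit). -/
def orbitSpan (ρ : Representation 𝔽 G₀ V) (v : V) : Submodule 𝔽 V :=
  Submodule.span 𝔽 {w | ∃ g, w = ρ g v}

/-- The subrepresentation generated by a vector under a subset `A` of the group. -/
def orbitSpanOn (ρ : Representation 𝔽 G₀ V) (A : Set G₀) (v : V) : Submodule 𝔽 V :=
  Submodule.span 𝔽 {w | ∃ g ∈ A, w = ρ g v}

/-- The quotient of a representation by an invariant submodule `N` is irreducible:
equivalently (by the lattice correspondence), `N ≠ ⊤` and any invariant submodule lying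
between `N` and `⊤` equals `N` or `⊤`. -/
def QuotientIrreducible (ρ : Representation 𝔽 G₀ V) (N : Submodule 𝔽 V) : Prop :=
  N ≠ ⊤ ∧ ∀ Ssub : Submodule 𝔽 V, Invt 𝔽 ρ Ssub → N ≤ Ssub → Ssub = N ∨ Ssub = ⊤

/-- The submodule of vectors invariant under all elements of the subset `A`. -/
def invariantsOn (ρ : Representation 𝔽 G₀ V) (A : Set G₀) : Submodule 𝔽 V where
  carrier := {v | ∀ g ∈ A, ρ g v = v}
  add_mem' := by
    intro a b ha hb g hg
    rw [map_add, ha g hg, hb g hg]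
  zero_mem' := by
    intro g hg
    rw [map_zero]
  smul_mem' := by
    intro c a ha g hg
    rw [map_smul, ha g hg]

/-- The space `Hom_G(ρ₁, ρ₂)` of equivariant linear maps, as a submodule of the linear maps. -/
def EquivHomSub {V₂ : Type} [AddCommGroup V₂] [Module 𝔽 V₂]
    (ρ₁ : Representation 𝔽 G₀ V) (ρ₂ : Representation 𝔽 G₀ V₂) :
    Submodule 𝔽 (V →ₗ[𝔽] V₂) where
  carrier := {φ | ∀ g x, φ (ρ₁ g x) = ρ₂ g (φ x)}
  add_mem' := by
    intro a b ha hb g x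
    simp only [LinearMap.add_apply, ha g x, hb g x, map_add]
  zero_mem' := by
    intro g x
    simp only [LinearMap.zero_apply, map_zero]
  smul_mem' := by
    intro c a ha g x
    simp only [LinearMap.smul_apply, ha g x, map_smul]

end Generic

section Weight

variable (W : Type) [AddCommGroup W] [Module 𝔽 W]
variable (σ : Representation 𝔽 ↥C.K W)

/-- Extension of `σ` to all of `G` (by `1` outside `K`); used to avoid coercion issues. -/
def sigma' : S.GG → Module.End 𝔽 W := fun g => if h : g ∈ C.K then σ ⟨g, h⟩ else 1

/-- `σ` is a weight of `K`: an irreducible smooth representation of `K` over `𝔽`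
factoring through `Γ_K = K / K¹` (automatically finite dimensional). -/
def IsWeight : Prop :=
  Nontrivial W ∧ FiniteDimensional 𝔽 W ∧
  (∀ Ssub : Submodule 𝔽 W, (∀ (k : ↥C.K) (w : W), w ∈ Ssub → σ k w ∈ Ssub) → Ssub = ⊥ ∨ Ssub = ⊤) ∧
  (∀ (g : S.GG) (hg : g ∈ C.K), g ∈ C.KoneS → σ ⟨g, hg⟩ = LinearMap.id)

/-- `σ` is one dimensional of the form `χ ∘ det`. -/
def IsDetWeight : Prop :=
  Module.finrank 𝔽 W = 1 ∧
  ∃ c : S.E → 𝔽, ∀ (g : S.GG) (hg : g ∈ C.K) (w : W), σ ⟨g, hg⟩ w = c ((S.mat g).det) • w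

/-- `j_σ : σ → σ` is the composition of the coinvariant projection `σ → σ_{I'_{1,K}}`
with the inverse of the natural isomorphism `σ^{I_{1,K}} ≅ σ_{I'_{1,K}}`:
it restricts to the identity on `σ^{I_{1,K}}` and kills the augmentation part of
`σ` with respect to `I'_{1,K}`. -/
def IsJ (jσ : W →ₗ[𝔽] W) : Prop :=
  (∀ w : W, (∀ g ∈ C.I1, sigma' C 𝔽 W σ g w = w) → jσ w = w) ∧
  (∀ (w : W) (g : S.GG), g ∈ C.I1' → jσ (sigma' C 𝔽 W σ g w - w) = 0)

/-- The defining conditions of the compact induction `ind_K^G σ`: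
`K`-equivariance on the left and compact support (finitely many cosets `K g`). -/
def IndCarrier : Set (S.GG → W) :=
  {f | (∀ (k : S.GG) (hk : k ∈ C.K) (g : S.GG), f (k * g) = σ ⟨k, hk⟩ (f g)) ∧
       ∃ s : Finset S.GG, ∀ g : S.GG, f g ≠ 0 → ∃ k ∈ C.K, ∃ t ∈ s, g = k * t}

/-- The compact induction `ind_K^G σ`, as a submodule of `G → W`. -/
def IndSub : Submodule 𝔽 (S.GG → W) where
  carrier := IndCarrier C 𝔽 W σ
  add_mem' := by
    rintro f g ⟨hf1, sf, hf2⟩ ⟨hg1, sg, hg2⟩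
    refine ⟨fun k hk x => by simp [hf1 k hk x, hg1 k hk x], sf ∪ sg, fun x hx => ?_⟩
    by_cases h : f x ≠ 0
    · obtain ⟨k, hk, t, ht, rfl⟩ := hf2 x h
      exact ⟨k, hk, t, Finset.mem_union_left _ ht, rfl⟩
    · push_neg at h
      have hgx : g x ≠ 0 := by
        intro h0
        apply hx
        simp [Pi.add_apply, h, h0]
      obtain ⟨k, hk, t, ht, rfl⟩ := hg2 x hgx
      exact ⟨k, hk, t, Finset.mem_union_right _ ht, rfl⟩
  zero_mem' := ⟨fun k hk g => by simp, ∅, fun g hg => absurd rfl hg⟩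
  smul_mem' := by
    rintro c f ⟨hf1, sf, hf2⟩
    refine ⟨fun k hk g => by simp [hf1 k hk g], sf, fun x hx => ?_⟩
    refine hf2 x ?_
    intro h0
    apply hx
    simp [h0]

lemma indAct_mem (g : S.GG) {f : S.GG → W} (hf : f ∈ IndCarrier C 𝔽 W σ) :
    (fun x => f (x * g)) ∈ IndCarrier C 𝔽 W σ := by
  obtain ⟨h1, s, h2⟩ := hf
  refine ⟨fun k hk x => ?_, s.image (· * g⁻¹), ?_⟩
  · show f (k * x * g) = _
    rw [mul_assoc]
    exact h1 k hk (x * g)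
  intro x hx
  obtain ⟨k, hk, t, ht, hxg⟩ := h2 (x * g) hx
  refine ⟨k, hk, t * g⁻¹, Finset.mem_image_of_mem _ ht, ?_⟩
  rw [← mul_assoc, ← hxg, mul_assoc, mul_inv_cancel, mul_one]

/-- The representation of `G` on `ind_K^G σ` by right translation. -/
def indRep : Representation 𝔽 S.GG ↥(IndSub C 𝔽 W σ) where
  toFun g :=
    { toFun := fun f => ⟨fun x => (f : S.GG → W) (x * g), indAct_mem C 𝔽 W σ g f.2⟩
      map_add' := fun f1 f2 => Subtype.ext (funext fun x => rfl)
      map_smul' := fun c f => Subtype.ext (funext fun x => rfl) }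
  map_one' := LinearMap.ext fun f => Subtype.ext (funext fun x => by simp [mul_one])
  map_mul' g h := LinearMap.ext fun f => Subtype.ext (funext fun x => by simp [mul_assoc])

/-- The function `[g, v] ∈ ind_K^G σ`: supported on `K g⁻¹`, with value `v` at `g⁻¹`. -/
def stdFn (g : S.GG) (v : W) : S.GG → W :=
  fun x => if h : x * g ∈ C.K then σ ⟨x * g, h⟩ v else 0

/-- The characterization of the family `f_n` (`n ∈ ℤ`) of `I_{1,K}`-invariant elements of
`ind_K^G σ`: `f_n` is supported on `K α⁻ⁿ I_{1,K}` and has value at `α⁻ⁿ` equal to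
`σ(β_K) v₀` for `n > 0` and `v₀` for `n ≤ 0`, where `v₀` is a fixed nonzero vector of
`σ^{I_{1,K}}`. -/
def IsFFamily (v0 : W) (ff : ℤ → ↥(IndSub C 𝔽 W σ)) : Prop :=
  v0 ≠ 0 ∧ (∀ g ∈ C.I1, sigma' C 𝔽 W σ g v0 = v0) ∧
  (∀ (n : ℤ) (g : S.GG), g ∈ C.I1 → indRep C 𝔽 W σ g (ff n) = ff n) ∧
  (∀ (n : ℤ) (x : S.GG), (ff n : S.GG → W) x ≠ 0 →
    ∃ k ∈ C.K, ∃ i ∈ C.I1, x = k * S.alphaE ^ (-n) * i) ∧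
  (∀ n : ℤ, 0 < n → (ff n : S.GG → W) (S.alphaE ^ (-n)) = sigma' C 𝔽 W σ C.βK v0) ∧
  (∀ n : ℤ, n ≤ 0 → (ff n : S.GG → W) (S.alphaE ^ (-n)) = v0)

/-- The characterization of the Hecke operator `T ∈ End_G(ind_K^G σ)`:
it is `G`-equivariant and satisfies
`T [1, v] = ∑_{u ∈ N_{n_K}/N_{n_K+2}} [u α⁻¹, j_σ σ(u⁻¹) v]
  + ∑_{u ∈ N_{n_K+1}/N_{n_K+2}} [β_K u α⁻¹, j_σ σ(β_K) v]`. -/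
def IsHeckeT (jσ : W →ₗ[𝔽] W) (T : Module.End 𝔽 ↥(IndSub C 𝔽 W σ)) : Prop :=
  (∀ (g : S.GG) (x : ↥(IndSub C 𝔽 W σ)),
    T (indRep C 𝔽 W σ g x) = indRep C 𝔽 W σ g (T x)) ∧
  (∀ (v : W) (x : ↥(IndSub C 𝔽 W σ)), (x : S.GG → W) = stdFn C 𝔽 W σ 1 v →
    ∀ (U2 U1 : Finset S.GG),
      S.IsReps (S.Nk C.nK) (S.Nk (C.nK + 2)) U2 →
      S.IsReps (S.Nk (C.nK + 1)) (S.Nk (C.nK + 2)) U1 →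
      ((T x : S.GG → W)) =
        (∑ u ∈ U2, stdFn C 𝔽 W σ (u * S.alphaE⁻¹) (jσ (sigma' C 𝔽 W σ u⁻¹ v))) +
        ∑ u ∈ U1, stdFn C 𝔽 W σ (C.βK * u * S.alphaE⁻¹) (jσ (sigma' C 𝔽 W σ C.βK v)))

/-- The eigencharacter `χ_σ` of `H₀/H₁` afforded by the (one-dimensional) space
`σ^{I_{1,K}}` with chosen basis vector `v₀`. -/
def IsChi (v0 : W) (χ : S.GG → 𝔽) : Prop :=
  (∀ h ∈ C.H0, sigma' C 𝔽 W σ h v0 = χ h • v0)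

/-- Right translation on functions `K → 𝔽` (the action on a (finite) principal series). -/
def PSact (k : ↥C.K) (f : ↥C.K → 𝔽) : ↥C.K → 𝔽 := fun x => f (x * k)

/-- The (inflation to `K` of the) finite principal series `Ind_𝔹^{Γ_K} χ`:
functions on `K`, invariant under right translation by `K¹`, left `I_{1,K}`-invariant and
left `(H₀, χ)`-equivariant. -/
def PSchiSub (χ : S.GG → 𝔽) : Submodule 𝔽 (↥C.K → 𝔽) where
  carrier := {f | (∀ b : ↥C.K, (b : S.GG) ∈ C.I1 → ∀ x, f (b * x) = f x) ∧
                  (∀ h : ↥C.K, (h : S.GG) ∈ C.H0 → ∀ x, f (h * x) = χ (h : S.GG) * f x) ∧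
                  (∀ z : ↥C.K, (z : S.GG) ∈ C.KoneS → ∀ x, f (x * z) = f x)}
  add_mem' := by
    rintro f g ⟨hf1, hf2, hf3⟩ ⟨hg1, hg2, hg3⟩
    exact ⟨fun b hb x => by simp [hf1 b hb x, hg1 b hb x],
           fun h hh x => by simp [hf2 h hh x, hg2 h hh x, mul_add],
           fun z hz x => by simp [hf3 z hz x, hg3 z hz x]⟩
  zero_mem' := ⟨fun b hb x => rfl, fun h hh x => by simp, fun z hz x => rfl⟩
  smul_mem' := by
    rintro c f ⟨hf1, hf2, hf3⟩
    refine ⟨fun b hb x => by simp [hf1 b hb x], fun h hh x => ?_, fun z hz x => by simp [hf3 z hz x]⟩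
    simp only [Pi.smul_apply, hf2 h hh x, smul_eq_mul]
    ring

/-- The principal series `Ind_𝔹^{Γ_K} 1` for the trivial character. -/
def PS1sub : Submodule 𝔽 (↥C.K → 𝔽) := PSchiSub C 𝔽 (fun _ => 1)

/-- `σ_{st}` is the Steinberg weight `st = (Ind_𝔹^{Γ_K} 1)/1`: there is a surjective
`K`-equivariant linear map from `Ind_𝔹^{Γ_K} 1` to it whose kernel is exactly the
constant functions. -/
def IsSteinberg {Wst : Type} [AddCommGroup Wst] [Module 𝔽 Wst]
    (σst : Representation 𝔽 ↥C.K Wst) : Prop :=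
  ∃ φ : ↥(PS1sub C 𝔽) →ₗ[𝔽] Wst, Function.Surjective φ ∧
    (∀ f : ↥(PS1sub C 𝔽), φ f = 0 ↔ ∃ c : 𝔽, (f : ↥C.K → 𝔽) = fun _ => c) ∧
    (∀ (k : ↥C.K) (f f' : ↥(PS1sub C 𝔽)),
      (f' : ↥C.K → 𝔽) = PSact C 𝔽 k (f : ↥C.K → 𝔽) → φ f' = σst k (φ f))

/-- `σ` is isomorphic to a twist of the Steinberg weight by a character. -/
def IsTwistSteinberg : Prop :=
  ∃ (c : ↥C.K →* 𝔽ˣ) (φ : ↥(PS1sub C 𝔽) →ₗ[𝔽] W), Function.Surjective φ ∧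
    (∀ f : ↥(PS1sub C 𝔽), φ f = 0 ↔ ∃ cc : 𝔽, (f : ↥C.K → 𝔽) = fun _ => cc) ∧
    (∀ (k : ↥C.K) (f f' : ↥(PS1sub C 𝔽)),
      (f' : ↥C.K → 𝔽) = PSact C 𝔽 k (f : ↥C.K → 𝔽) →
        φ f' = (c k : 𝔽) • σ k (φ f))


/-- The `K`-subrepresentation of the quotient `(ind_K^G σ) / (range T)` generated by the
image of a vector `v`. -/
def genQuot (T : Module.End 𝔽 ↥(IndSub C 𝔽 W σ)) (v : ↥(IndSub C 𝔽 W σ)) :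
    Submodule 𝔽 (↥(IndSub C 𝔽 W σ) ⧸ LinearMap.range T) :=
  Submodule.span 𝔽 {w | ∃ k ∈ C.K, w = Submodule.Quotient.mk (indRep C 𝔽 W σ k v)}

end Weight

/-- Smoothness of a representation of `G`: every vector is fixed by some congruence
subgroup (equivalently, has open stabilizer). -/
def SmoothRep {V : Type} [AddCommGroup V] [Module 𝔽 V] (ρ : Representation 𝔽 S.GG V) : Prop :=
  ∀ v : V, ∃ n : ℕ, ∀ g ∈ S.cong n, ρ g v = v

end RepTheory

end U21

namespace U21

namespace Setting

variable (S : Setting)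

lemma mat_mul (g h : S.GG) : S.mat (g * h) = S.mat g * S.mat h := rfl

lemma mat_betaE : S.mat S.betaE = S.betaM := rfl

lemma mat_alphaE : S.mat S.alphaE = S.alphaM := rfl

lemma mat_alphaE_inv : S.mat S.alphaE⁻¹ = S.alphaMinv := rfl

variable {S}

lemma mat_injective : Function.Injective S.mat :=
  fun _ _ h => Subtype.ext (Units.ext h)

lemma mul_mem_pE {k : ℤ} {a y : S.E} (ha : a ∈ S.O) (hy : y ∈ S.pE k) : a * y ∈ S.pE k := by
  obtain ⟨w, hw, rfl⟩ := hy
  exact ⟨a * w, S.O.mul_mem ha hw, by ring⟩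

lemma conj_mem_pE {k : ℤ} {y : S.E} (hy : y ∈ S.pE k) : S.conj y ∈ S.pE k := by
  obtain ⟨w, hw, rfl⟩ := hy
  exact ⟨S.conj w, S.conj_O w hw, by rw [map_mul, map_zpow₀, S.unif_conj]⟩

lemma unif_zpow_mul_mem_pE {k : ℤ} (j : ℤ) {y : S.E} (hy : y ∈ S.pE k) :
    S.ϖ ^ j * y ∈ S.pE (k + j) := by
  obtain ⟨w, hw, rfl⟩ := hy
  exact ⟨w, hw, by rw [zpow_add₀ S.unif_ne]; ring⟩

lemma betaE_mul_self : S.betaE * S.betaE = 1 := mat_injective S.beta_mul_beta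

lemma betaE_inv : S.betaE⁻¹ = S.betaE := inv_eq_of_mul_eq_one_left betaE_mul_self

lemma betaE_alphaE_inv_betaE : S.betaE * S.alphaE⁻¹ * S.betaE = S.alphaE := by
  apply mat_injective
  rw [mat_mul, mat_mul, mat_betaE, mat_alphaE_inv, mat_alphaE]
  ext i j
  fin_cases i <;> fin_cases j <;>
    simp [betaM, alphaM, alphaMinv, Matrix.mul_apply, Fin.sum_univ_three]

lemma betaPr_mul_self : S.betaPr * S.betaPr = 1 := by
  rw [betaPr, ← mul_assoc, betaE_alphaE_inv_betaE, mul_inv_cancel]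

/-- Membership in `N'_k` is membership in `N_k` after conjugation by `β`. -/
lemma mem_N'k_iff {k : ℤ} {g : S.GG} :
    g ∈ S.N'k k ↔ S.betaE * g * S.betaE ∈ S.Nk k := by
  constructor
  · rintro ⟨x, y, hxy, hy, hg⟩
    refine ⟨-S.conj x, y, ?_, hy, ?_⟩
    · rw [map_neg, S.conj_invol, ← hxy]; ring
    · rw [mat_mul, mat_mul, mat_betaE, hg]
      ext i j
      fin_cases i <;> fin_cases j <;>
        simp [betaM, nM, n'M, Matrix.mul_apply, Fin.sum_univ_three, S.conj_invol]
  · rintro ⟨x, y, hxy, hy, hg⟩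
    refine ⟨-S.conj x, y, ?_, hy, ?_⟩
    · rw [map_neg, S.conj_invol, ← hxy]; ring
    · have : g = S.betaE * (S.betaE * g * S.betaE) * S.betaE := by
        rw [mul_assoc, mul_assoc, mul_assoc, betaE_mul_self, mul_one, ← mul_assoc,
          betaE_mul_self, one_mul]
      rw [this, mat_mul, mat_mul, mat_betaE, hg]
      ext i j
      fin_cases i <;> fin_cases j <;>
        simp [betaM, nM, n'M, Matrix.mul_apply, Fin.sum_univ_three, S.conj_invol]

lemma betaE_conj_mem_N'k_iff {k : ℤ} {g : S.GG} :
    S.betaE * g * S.betaE ∈ S.N'k k ↔ g ∈ S.Nk k := by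
  have : S.betaE * (S.betaE * g * S.betaE) * S.betaE = g := by
    rw [mul_assoc, mul_assoc, mul_assoc, betaE_mul_self, mul_one, ← mul_assoc,
      betaE_mul_self, one_mul]
  rw [mem_N'k_iff, this]

lemma inv_mem_Nk {k : ℤ} {g : S.GG} (hg : g ∈ S.Nk k) : g⁻¹ ∈ S.Nk k := by
  obtain ⟨x, y, hxy, hy, hg⟩ := hg
  refine ⟨-x, S.conj y, ?_, conj_mem_pE hy, ?_⟩
  · rw [map_neg, S.conj_invol, ← hxy]; ring
  · have h1 : S.nM x y * S.nM (-x) (S.conj y) = 1 := by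
      ext i j
      fin_cases i <;> fin_cases j <;>
        simp [nM, Matrix.mul_apply, Fin.sum_univ_three]
      rw [← hxy]; ring
    have h2 : S.mat g⁻¹ * S.nM x y = 1 := by
      rw [← hg, ← mat_mul, inv_mul_cancel]; rfl
    exact left_inv_eq_right_inv h2 h1

lemma inv_mem_N'k {k : ℤ} {g : S.GG} (hg : g ∈ S.N'k k) : g⁻¹ ∈ S.N'k k := by
  rw [mem_N'k_iff] at hg ⊢
  simpa [mul_inv_rev, betaE_inv, mul_assoc] using inv_mem_Nk hg

/-- The diagonal elements of `G` with entries in `o_E`. -/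
def integralDiag (S : Setting) : Set S.GG :=
  {g | ∃ a b c : S.E, a ∈ S.O ∧ b ∈ S.O ∧ c ∈ S.O ∧ S.mat g = !![a,0,0;0,b,0;0,0,c]}

lemma diag_relations {g : S.GG} {a b c : S.E} (hg : S.mat g = !![a,0,0;0,b,0;0,0,c]) :
    a * S.conj c = 1 ∧ b * S.conj b = 1 ∧ c * S.conj a = 1 := by
  have h : (S.mat g).transpose * S.betaM * ((S.mat g).map S.conj) = S.betaM := g.2
  rw [hg] at h
  refine ⟨?_, ?_, ?_⟩
  · simpa [betaM, Matrix.mul_apply, Fin.sum_univ_three] using congrFun (congrFun h 0) 2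
  · simpa [betaM, Matrix.mul_apply, Fin.sum_univ_three] using congrFun (congrFun h 1) 1
  · simpa [betaM, Matrix.mul_apply, Fin.sum_univ_three] using congrFun (congrFun h 2) 0

lemma mat_inv_of_diag {g : S.GG} {a b c : S.E} (hg : S.mat g = !![a,0,0;0,b,0;0,0,c]) :
    S.mat g⁻¹ = !![S.conj c,0,0;0,S.conj b,0;0,0,S.conj a] := by
  obtain ⟨h0, h1, h2⟩ := diag_relations hg
  have e : S.mat g * !![S.conj c,0,0;0,S.conj b,0;0,0,S.conj a] = 1 := by
    rw [hg]
    ext i j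
    fin_cases i <;> fin_cases j <;>
      simp [Matrix.mul_apply, Fin.sum_univ_three, h0, h1, h2]
  have e' : S.mat g⁻¹ * S.mat g = 1 := by
    rw [← mat_mul, inv_mul_cancel]; rfl
  exact left_inv_eq_right_inv e' e

lemma inv_mem_integralDiag {d : S.GG} (hd : d ∈ S.integralDiag) : d⁻¹ ∈ S.integralDiag := by
  obtain ⟨a, b, c, ha, hb, hc, hg⟩ := hd
  exact ⟨_, _, _, S.conj_O c hc, S.conj_O b hb, S.conj_O a ha, mat_inv_of_diag hg⟩

lemma betaE_conj_mem_integralDiag {d : S.GG} (hd : d ∈ S.integralDiag) :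
    S.betaE * d * S.betaE ∈ S.integralDiag := by
  obtain ⟨a, b, c, ha, hb, hc, hg⟩ := hd
  refine ⟨c, b, a, hc, hb, ha, ?_⟩
  rw [mat_mul, mat_mul, mat_betaE, hg]
  ext i j
  fin_cases i <;> fin_cases j <;> simp [betaM, Matrix.mul_apply, Fin.sum_univ_three]

lemma commute_alphaE {d : S.GG} (hd : d ∈ S.integralDiag) : Commute d S.alphaE := by
  obtain ⟨a, b, c, -, -, -, hg⟩ := hd
  apply mat_injective
  rw [mat_mul, mat_mul, mat_alphaE, hg]
  ext i j
  fin_cases i <;> fin_cases j <;> simp [alphaM, Matrix.mul_apply, Fin.sum_univ_three, mul_comm]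

lemma diag_conj_mem_Nk {k : ℤ} {d g : S.GG} (hd : d ∈ S.integralDiag) (hg : g ∈ S.Nk k) :
    d * g * d⁻¹ ∈ S.Nk k := by
  obtain ⟨a, b, c, ha, hb, hc, hd⟩ := hd
  obtain ⟨x, y, hxy, hy, hg⟩ := hg
  obtain ⟨h0, h1, h2⟩ := diag_relations hd
  refine ⟨a * S.conj b * x, a * S.conj a * y, ?_,
    mul_mem_pE (S.O.mul_mem ha (S.conj_O a ha)) hy, ?_⟩
  · simp only [map_mul, S.conj_invol]
    linear_combination (a * S.conj a) * hxy + (a * S.conj a * x * S.conj x) * h1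
  · rw [mat_mul, mat_mul, mat_inv_of_diag hd, hd, hg]
    ext i j
    fin_cases i <;> fin_cases j <;>
      simp [nM, Matrix.mul_apply, Fin.sum_univ_three, S.conj_invol, h0, h1, h2] <;> ring

lemma diag_conj_mem_N'k {k : ℤ} {d g : S.GG} (hd : d ∈ S.integralDiag) (hg : g ∈ S.N'k k) :
    d * g * d⁻¹ ∈ S.N'k k := by
  rw [mem_N'k_iff] at hg ⊢
  have e : S.betaE * (d * g * d⁻¹) * S.betaE =
      (S.betaE * d * S.betaE) * (S.betaE * g * S.betaE) * (S.betaE * d * S.betaE)⁻¹ := by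
    have h2 (x : S.GG) : S.betaE * (S.betaE * x) = x := by
      rw [← mul_assoc, betaE_mul_self, one_mul]
    simp only [mul_inv_rev, betaE_inv, mul_assoc, h2]
  rw [e]
  exact diag_conj_mem_Nk (betaE_conj_mem_integralDiag hd) hg

lemma alphaE_conj_mem_Nk {k : ℤ} {g : S.GG} (hg : g ∈ S.Nk k) :
    S.alphaE * g * S.alphaE⁻¹ ∈ S.Nk (k - 2) := by
  obtain ⟨x, y, hxy, hy, hg⟩ := hg
  refine ⟨S.ϖ⁻¹ * x, S.ϖ ^ (-2 : ℤ) * y, ?_, unif_zpow_mul_mem_pE (-2) hy, ?_⟩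
  · simp only [map_mul, map_inv₀, map_zpow₀, S.unif_conj]
    rw [zpow_neg, zpow_ofNat, ← inv_pow]
    linear_combination (S.ϖ⁻¹ ^ 2) * hxy
  · rw [mat_mul, mat_mul, mat_alphaE, mat_alphaE_inv, hg]
    ext i j
    fin_cases i <;> fin_cases j <;>
      simp [nM, alphaM, alphaMinv, Matrix.mul_apply, Fin.sum_univ_three, S.unif_conj,
        S.unif_ne, zpow_neg] <;> field_simp

lemma alphaE_inv_conj_mem_Nk {k : ℤ} {g : S.GG} (hg : g ∈ S.Nk k) :
    S.alphaE⁻¹ * g * S.alphaE ∈ S.Nk (k + 2) := by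
  obtain ⟨x, y, hxy, hy, hg⟩ := hg
  refine ⟨S.ϖ * x, S.ϖ ^ (2 : ℤ) * y, ?_, unif_zpow_mul_mem_pE 2 hy, ?_⟩
  · simp only [map_mul, map_zpow₀, S.unif_conj]
    rw [zpow_ofNat]
    linear_combination (S.ϖ ^ 2) * hxy
  · rw [mat_mul, mat_mul, mat_alphaE, mat_alphaE_inv, hg]
    ext i j
    fin_cases i <;> fin_cases j <;>
      simp [nM, alphaM, alphaMinv, Matrix.mul_apply, Fin.sum_univ_three, S.unif_conj,
        S.unif_ne] <;> ring

lemma alphaE_inv_conj_mem_N'k {k : ℤ} {g : S.GG} (hg : g ∈ S.N'k k) :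
    S.alphaE⁻¹ * g * S.alphaE ∈ S.N'k (k - 2) := by
  rw [mem_N'k_iff] at hg ⊢
  have e : S.betaE * (S.alphaE⁻¹ * g * S.alphaE) * S.betaE =
      S.alphaE * (S.betaE * g * S.betaE) * S.alphaE⁻¹ := by
    have h1 : S.betaE * S.alphaE⁻¹ = S.alphaE * S.betaE := by
      nth_rewrite 2 [← betaE_alphaE_inv_betaE]
      rw [mul_assoc _ S.betaE, betaE_mul_self, mul_one]
    have h2 : S.alphaE * S.betaE = S.betaE * S.alphaE⁻¹ := h1.symm
    calc _ = (S.betaE * S.alphaE⁻¹) * g * (S.alphaE * S.betaE) := by group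
      _ = _ := by rw [h1]; nth_rewrite 2 [h2]; group
  rw [e]
  exact alphaE_conj_mem_Nk hg

lemma IsReps.sum_eq {A B : Set S.GG} (hB : ∀ b ∈ B, b⁻¹ ∈ B) {U U' : Finset S.GG}
    (hU : S.IsReps A B U) (hU' : S.IsReps A B U') {M : Type*} [AddCommMonoid M]
    (f : S.GG → M) (hf : ∀ u w : S.GG, u⁻¹ * w ∈ B → f w = f u) :
    ∑ u ∈ U, f u = ∑ u ∈ U', f u := by
  choose! i hi hi' using fun a (ha : a ∈ A) => hU'.2 a ha
  choose! j hj hj' using fun a (ha : a ∈ A) => hU.2 a ha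
  have symm : ∀ u w : S.GG, u⁻¹ * w ∈ B → w⁻¹ * u ∈ B := fun u w h => by
    simpa using hB _ h
  refine Finset.sum_bij' (fun u _ => i u) (fun u _ => j u)
    (fun u hu => (hi u (hU.1 hu)).1) (fun u hu => (hj u (hU'.1 hu)).1) ?_ ?_ ?_
  · intro u hu
    obtain ⟨h1, h2⟩ := hi u (hU.1 hu)
    exact (hj' (i u) (hU'.1 h1) u ⟨hu, symm _ _ h2⟩).symm
  · intro u hu
    obtain ⟨h1, h2⟩ := hj u (hU'.1 hu)
    exact (hi' (j u) (hU.1 h1) u ⟨hu, symm _ _ h2⟩).symm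
  · intro u hu
    exact (hf _ _ (hi u (hU.1 hu)).2).symm

lemma IsReps.conj {A B : Set S.GG} {d : S.GG}
    (hA : ∀ a ∈ A, d * a * d⁻¹ ∈ A) (hA' : ∀ a ∈ A, d⁻¹ * a * d ∈ A)
    (hB : ∀ b ∈ B, d * b * d⁻¹ ∈ B) (hB' : ∀ b ∈ B, d⁻¹ * b * d ∈ B) {U : Finset S.GG}
    (hU : S.IsReps A B U) : S.IsReps A B (U.image fun u => d⁻¹ * u * d) := by
  refine ⟨?_, fun a ha => ?_⟩
  · intro w hw
    obtain ⟨u, hu, rfl⟩ := Finset.mem_image.1 hw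
    exact hA' u (hU.1 hu)
  · obtain ⟨u, ⟨hu, hub⟩, huniq⟩ := hU.2 _ (hA a ha)
    refine ⟨d⁻¹ * u * d, ⟨Finset.mem_image_of_mem _ hu, ?_⟩, ?_⟩
    · have := hB' _ hub
      rwa [show d⁻¹ * ((d * a * d⁻¹)⁻¹ * u) * d = a⁻¹ * (d⁻¹ * u * d) by group] at this
    · rintro w ⟨hw, hwb⟩
      obtain ⟨z, hz, rfl⟩ := Finset.mem_image.1 hw
      have := hB _ hwb
      rw [show d * (a⁻¹ * (d⁻¹ * z * d)) * d⁻¹ = (d * a * d⁻¹)⁻¹ * z by group] at this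
      rw [huniq z ⟨hz, this⟩]

/-- Translating the argument of an averaging operator by `h` amounts to translating its value
by `d = w h w⁻¹`, provided `d` normalizes the groups averaged over. -/
lemma IsReps.sum_translate {A B : Set S.GG} {d h w : S.GG} (hBinv : ∀ b ∈ B, b⁻¹ ∈ B)
    (hA : ∀ a ∈ A, d * a * d⁻¹ ∈ A) (hA' : ∀ a ∈ A, d⁻¹ * a * d ∈ A)
    (hB : ∀ b ∈ B, d * b * d⁻¹ ∈ B) (hB' : ∀ b ∈ B, d⁻¹ * b * d ∈ B)
    {U : Finset S.GG} (hU : S.IsReps A B U) (hw : w * h = d * w)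
    {𝔽 V : Type} [Field 𝔽] [AddCommGroup V] [Module 𝔽 V] (ρ : Representation 𝔽 S.GG V)
    {v : V} (hv : ∀ b ∈ B, ρ (w⁻¹ * b * w) v = v) :
    ∑ u ∈ U, ρ (u * w) (ρ h v) = ρ d (∑ u ∈ U, ρ (u * w) v) := by
  rw [hU.sum_eq hBinv (hU.conj hA hA' hB hB') (fun u => ρ (u * w) v), Finset.sum_image, map_sum]
  · refine Finset.sum_congr rfl fun u _ => ?_
    rw [← Module.End.mul_apply, ← Module.End.mul_apply, ← map_mul, ← map_mul, mul_assoc, hw]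
    congr 2
    group
  · intro u _ u' _ huu
    simpa using huu
  · intro u u' hb
    have := congrArg (ρ (u * w)) (hv _ hb)
    rw [← Module.End.mul_apply, ← map_mul] at this
    rw [← this]
    congr 2
    group

end Setting

namespace Chamber

open Setting

variable {S : Setting} (C : Chamber S)

lemma H1_subset_integralDiag : C.H1 ⊆ S.integralDiag := by
  rintro h ⟨⟨a, b, c, hm⟩, hI⟩
  rcases C.cases with ⟨-, -, -, hI1, -⟩ | ⟨-, -, -, hI1, -⟩ <;> rw [hI1] at hI
  · have hK := hI.1.1
    exact ⟨a, b, c, by simpa [hm] using hK 0 0, by simpa [hm] using hK 1 1,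
      by simpa [hm] using hK 2 2, hm⟩
  · obtain ⟨h0, -, -, -, h1, -, -, -, h2⟩ := hI.1.1
    exact ⟨a, b, c, by simpa [hm] using h0, by simpa [hm] using h1, by simpa [hm] using h2, hm⟩

lemma βK_mul_self : C.βK * C.βK = 1 := by
  rcases C.cases with ⟨-, -, -, -, -, h, -⟩ | ⟨-, -, -, -, -, h, -⟩ <;> rw [h]
  · exact betaE_mul_self
  · exact betaPr_mul_self

lemma βK_inv : C.βK⁻¹ = C.βK := inv_eq_of_mul_eq_one_left C.βK_mul_self

lemma βK_conj_mem_integralDiag {d : S.GG} (hd : d ∈ S.integralDiag) :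
    C.βK * d * C.βK ∈ S.integralDiag := by
  rcases C.cases with ⟨-, -, -, -, -, h, -⟩ | ⟨-, -, -, -, -, h, -⟩ <;> rw [h]
  · exact betaE_conj_mem_integralDiag hd
  · have e : S.betaPr * d * S.betaPr = S.betaE * d * S.betaE := by
      calc S.betaPr * d * S.betaPr
          = S.betaE * (S.alphaE⁻¹ * d) * S.betaE * S.alphaE⁻¹ := by
            simp only [betaPr, mul_assoc]
        _ = S.betaE * d * (S.alphaE⁻¹ * S.betaE * S.alphaE⁻¹) := by
            rw [← (commute_alphaE hd).inv_right.eq]; simp only [mul_assoc]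
        _ = _ := by
            have : S.alphaE⁻¹ * S.betaE * S.alphaE⁻¹ = S.betaE := by
              rw [mul_assoc, inv_mul_eq_iff_eq_mul]
              nth_rewrite 2 [← betaE_alphaE_inv_betaE]
              rw [mul_assoc _ S.betaE, betaE_mul_self, mul_one]
            rw [this]
    rw [e]
    exact betaE_conj_mem_integralDiag hd

lemma βK_conj_Nk {g : S.GG} (hg : g ∈ S.Nk (C.nK + 1)) : C.βK⁻¹ * g * C.βK ∈ S.N'k C.mK := by
  rw [C.βK_inv]
  rcases C.cases with ⟨-, -, -, -, -, h, hn, hm, -⟩ | ⟨-, -, -, -, -, h, hn, hm, -⟩ <;>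
    rw [hn] at hg <;> rw [hm, h]
  · exact betaE_conj_mem_N'k_iff.2 hg
  · have e : S.betaPr * g * S.betaPr = S.betaE * (S.alphaE⁻¹ * g * S.alphaE) * S.betaE := by
      rw [betaPr]
      nth_rewrite 4 [← betaE_alphaE_inv_betaE]
      simp only [mul_assoc, betaE_mul_self, mul_one]
    rw [e, betaE_conj_mem_N'k_iff]
    exact alphaE_inv_conj_mem_Nk hg

lemma βK_alphaE_conj_N'k {g : S.GG} (hg : g ∈ S.N'k (C.mK + 1)) :
    (C.βK * S.alphaE⁻¹)⁻¹ * g * (C.βK * S.alphaE⁻¹) ∈ S.Nk C.nK := by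
  rcases C.cases with ⟨-, -, -, -, -, h, hn, hm, -⟩ | ⟨-, -, -, -, -, h, hn, hm, -⟩ <;>
    rw [hm, mem_N'k_iff] at hg <;> rw [hn, h]
  · have := alphaE_conj_mem_Nk hg
    norm_num at this
    simpa [mul_assoc, betaE_inv] using this
  · have := alphaE_conj_mem_Nk (alphaE_conj_mem_Nk hg)
    norm_num at this
    simpa [betaPr, mul_assoc, betaE_inv] using this

end Chamber

/-- For `h ∈ H₁`: `S_K(h v) = (β_K h β_K) S_K(v)` and
`S_-(h v) = (β_K h β_K) S_-(v)`. -/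
theorem stmt15
    (S : Setting) (C : Chamber S)
    (𝔽 : Type) [Field 𝔽] [IsAlgClosed 𝔽] [Algebra (ZMod S.p) 𝔽]
    [Algebra.IsAlgebraic (ZMod S.p) 𝔽]
    (V : Type) [AddCommGroup V] [Module 𝔽 V]
    (ρ : Representation 𝔽 S.GG V) (hρ : SmoothRep 𝔽 ρ)
    (h : S.GG) (hh : h ∈ C.H1) :
    (∀ v : V, (∀ u ∈ S.N'k C.mK, ρ u v = v) →
      ∀ U : Finset S.GG, S.IsReps (S.Nk C.nK) (S.Nk (C.nK + 1)) U →
        ∑ u ∈ U, ρ (u * C.βK) (ρ h v) =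
          ρ (C.βK * h * C.βK) (∑ u ∈ U, ρ (u * C.βK) v)) ∧
    (∀ v : V, (∀ u ∈ S.Nk C.nK, ρ u v = v) →
      ∀ U' : Finset S.GG, S.IsReps (S.N'k C.mK) (S.N'k (C.mK + 1)) U' →
        ∑ u ∈ U', ρ (u * C.βK * S.alphaE⁻¹) (ρ h v) =
          ρ (C.βK * h * C.βK) (∑ u ∈ U', ρ (u * C.βK * S.alphaE⁻¹) v)) := by
  have hd := C.H1_subset_integralDiag hh
  have hd' := C.βK_conj_mem_integralDiag hd
  have hd'inv := Setting.inv_mem_integralDiag hd'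
  have hβ : C.βK * h = C.βK * h * C.βK * C.βK := by
    rw [mul_assoc _ C.βK C.βK, C.βK_mul_self, mul_one]
  refine ⟨fun v hv U hU => ?_, fun v hv U hU => ?_⟩
  · refine hU.sum_translate (fun b hb => Setting.inv_mem_Nk hb)
      (fun a ha => Setting.diag_conj_mem_Nk hd' ha) (fun a ha => ?_)
      (fun a ha => Setting.diag_conj_mem_Nk hd' ha) (fun a ha => ?_) hβ ρ
      (fun b hb => hv _ (C.βK_conj_Nk hb))
    all_goals simpa using Setting.diag_conj_mem_Nk hd'inv ha
  · have hw : C.βK * S.alphaE⁻¹ * h = C.βK * h * C.βK * (C.βK * S.alphaE⁻¹) := by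
      rw [← mul_assoc, ← hβ, mul_assoc, mul_assoc,
        (Setting.commute_alphaE hd).inv_right.eq]
    simp only [mul_assoc _ C.βK S.alphaE⁻¹]
    refine hU.sum_translate (fun b hb => Setting.inv_mem_N'k hb)
      (fun a ha => Setting.diag_conj_mem_N'k hd' ha) (fun a ha => ?_)
      (fun a ha => Setting.diag_conj_mem_N'k hd' ha) (fun a ha => ?_) hw ρ
      (fun b hb => hv _ (C.βK_alphaE_conj_N'k hb))
    all_goals simpa using Setting.diag_conj_mem_N'k hd'inv ha

end U21
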